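/- Let the encoder be learned from the data: a learning algorithm A maps datasets of size n to encoders in a finite family ℳ, φ^S = A(S) for S ~ P^{⊗n}, and for the realized dataset s the learned model is f^s = g^s∘φ^s with Z^s = φ^s(X) (all quantities Z_y, c^y, typical sets, G₂, G₃ computed with φ^s and g^s). For λ > 0 and δ ∈ (0,1) define C_λ = 2^{−λH(φ^S)} · Σ_{q∈ℳ, P(φ^S=q)>0} P(φ^S=q)^{1−λ}, G₄ = (1/λ)·log₂(C_λ/δ) + H(φ^S|S), and q̃ = (I(φ^S;S) + G₄)·ln 2 + ln 2. Then for every γ > 0, λ > 0 and δ > 0, with probability at least 1 − δ over the draw of s ~ P^{⊗n}: Δ(s) ≤ G₃ · √( ( (I(X;Z^s|Y) + I(φ^S;S) + G₂ + G₄)·ln 2 + ln(4|𝒴|/δ) ) / n ) + G₁(q̃) / √n, where G₁(q) = ℒ(f^s,s)·√(2γ|𝒴|)·√(q + ln(2|𝒴|/δ)) / n^{1/4} + γ·ℛ(f^s). -/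

import Mathlib

open Real Finset
open scoped Classical

/-- Base-`b` Shannon entropy of a finitely supported distribution `p`
(the convention `0·log 0 = 0` is automatic since `Real.logb b 0 = 0`). -/
noncomputable def entB {α : Type*} [Fintype α] (b : ℝ) (p : α → ℝ) : ℝ :=
  -∑ a, p a * Real.logb b (p a)

theorem sum_mul_exp_sub_mean_le {α : Type*} [Fintype α] (w g : α → ℝ) (hw : ∀ a, 0 ≤ w a)
    (hw1 : ∑ a, w a = 1) (c : ℝ) (hg : ∀ a b, |g a - g b| ≤ c) (t : ℝ) :
    ∑ a, w a * exp (t * (g a - ∑ b, w b * g b)) ≤ exp (t ^ 2 * c ^ 2 / 8) := by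
  have hne : Nonempty α := by
    by_contra h
    rw [not_nonempty_iff] at h
    simp at hw1
  let _ : MeasurableSpace α := ⊤
  have hsum : ∑ a, ENNReal.ofReal (w a) = 1 := by
    rw [← ENNReal.ofReal_sum_of_nonneg fun a _ => hw a, hw1, ENNReal.ofReal_one]
  set μ := (PMF.ofFintype (fun a => ENNReal.ofReal (w a)) hsum).toMeasure
  have hint : ∀ F : α → ℝ, ∫ a, F a ∂μ = ∑ a, w a * F a := by
    intro F
    rw [PMF.integral_eq_sum]
    simp [ENNReal.toReal_ofReal (hw _)]
  obtain ⟨a₀, -, ha₀⟩ := exists_min_image univ g univ_nonempty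
  have hc : 0 ≤ c := (abs_nonneg _).trans (hg a₀ a₀)
  have h := ProbabilityTheory.hasSubgaussianMGF_of_mem_Icc (μ := μ) (X := g) (a := g a₀)
    (b := g a₀ + c) (Measurable.aemeasurable fun _ _ => trivial)
    (Filter.Eventually.of_forall fun a => ⟨ha₀ a (mem_univ a), by
      have := (abs_le.1 (hg a a₀)).2
      linarith⟩)
  have h' := h.mgf_le t
  simp only [ProbabilityTheory.mgf, hint] at h'
  refine h'.trans (exp_le_exp.2 (le_of_eq ?_))
  simp
  rw [div_pow, sq_abs]
  ring

theorem sum_prod_mul_exp_sub_mean_le {m : ℕ} (E : Fin m → Type*) [∀ i, Fintype (E i)]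
    (ν : ∀ i, E i → ℝ) (hν0 : ∀ i e, 0 ≤ ν i e) (hν1 : ∀ i, ∑ e, ν i e = 1)
    (f : (∀ i, E i) → ℝ) (c : ℝ)
    (hf : ∀ i (ξ ξ' : ∀ i, E i), (∀ j, j ≠ i → ξ j = ξ' j) → |f ξ - f ξ'| ≤ c) (t : ℝ) :
    ∑ ξ, (∏ i, ν i (ξ i)) * exp (t * (f ξ - ∑ ξ', (∏ i, ν i (ξ' i)) * f ξ'))
      ≤ exp (m * t ^ 2 * c ^ 2 / 8) := by
  induction m with
  | zero => simp
  | succ m ih =>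
    have split : ∀ F : (∀ i, E i) → ℝ, ∑ ξ, (∏ i, ν i (ξ i)) * F ξ =
        ∑ e, ν 0 e * ∑ ξ : ∀ i : Fin m, E i.succ,
          (∏ i, ν i.succ (ξ i)) * F (Fin.cons e ξ) := by
      intro F
      rw [← (Fin.consEquiv E).sum_comp, Fintype.sum_prod_type]
      refine sum_congr rfl fun e _ => ?_
      rw [mul_sum]
      refine sum_congr rfl fun ξ _ => ?_
      simp [Fin.consEquiv, Fin.prod_univ_succ, mul_assoc]
    have htot : ∑ ξ : ∀ i : Fin m, E i.succ, ∏ i, ν i.succ (ξ i) = 1 := by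
      rw [← Fintype.piFinset_univ, ← prod_univ_sum]
      simp [hν1]
    have hpos : ∀ ξ : ∀ i : Fin m, E i.succ, 0 ≤ ∏ i, ν i.succ (ξ i) :=
      fun ξ => prod_nonneg fun i _ => hν0 _ _
    set g : E 0 → ℝ := fun e => ∑ ξ : ∀ i : Fin m, E i.succ,
      (∏ i, ν i.succ (ξ i)) * f (Fin.cons e ξ)
    have hg : ∀ a b, |g a - g b| ≤ c := by
      intro a b
      rw [← sum_sub_distrib]
      refine (abs_sum_le_sum_abs _ _).trans ?_
      calc _ ≤ ∑ ξ : ∀ i : Fin m, E i.succ, (∏ i, ν i.succ (ξ i)) * c := by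
            refine sum_le_sum fun ξ _ => ?_
            rw [← mul_sub, abs_mul, abs_of_nonneg (hpos ξ)]
            refine mul_le_mul_of_nonneg_left (hf 0 _ _ fun j hj => ?_) (hpos ξ)
            obtain ⟨k, rfl⟩ := Fin.exists_succ_eq.2 hj
            simp
        _ = c := by rw [← sum_mul, htot, one_mul]
    have hin : ∀ e, ∑ ξ : ∀ i : Fin m, E i.succ, (∏ i, ν i.succ (ξ i)) *
        exp (t * (f (Fin.cons e ξ) - g e)) ≤ exp (m * t ^ 2 * c ^ 2 / 8) := by
      intro e
      refine ih (fun i => E i.succ) (fun i => ν i.succ) (fun i => hν0 _) (fun i => hν1 _)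
        (fun ξ => f (Fin.cons e ξ)) fun i ξ ξ' h => hf i.succ _ _ fun j hj => ?_
      induction j using Fin.cases with
      | zero => simp
      | succ k => simpa using h k fun hk => hj (by rw [hk])
    rw [split, split]
    change ∑ e, ν 0 e * ∑ ξ : ∀ i : Fin m, E i.succ, (∏ i, ν i.succ (ξ i)) *
      exp (t * (f (Fin.cons e ξ) - ∑ e, ν 0 e * g e)) ≤ _
    set M := ∑ e, ν 0 e * g e with hM
    calc _ = ∑ e, ν 0 e * exp (t * (g e - M)) * ∑ ξ : ∀ i : Fin m, E i.succ,
            (∏ i, ν i.succ (ξ i)) * exp (t * (f (Fin.cons e ξ) - g e)) := by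
          refine sum_congr rfl fun e _ => ?_
          rw [mul_assoc, mul_sum (a := exp _)]
          congr 1
          refine sum_congr rfl fun ξ _ => ?_
          rw [mul_left_comm, ← exp_add]
          ring_nf
      _ ≤ ∑ e, ν 0 e * exp (t * (g e - M)) * exp (m * t ^ 2 * c ^ 2 / 8) :=
          sum_le_sum fun e _ => mul_le_mul_of_nonneg_left (hin e)
            (mul_nonneg (hν0 _ _) (exp_pos _).le)
      _ ≤ exp (t ^ 2 * c ^ 2 / 8) * exp (m * t ^ 2 * c ^ 2 / 8) := by
          rw [← sum_mul]
          exact mul_le_mul_of_nonneg_right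
            (sum_mul_exp_sub_mean_le _ _ (hν0 0) (hν1 0) c hg t) (exp_pos _).le
      _ = _ := by
          rw [← exp_add]
          push_cast
          ring_nf

/-- **McDiarmid's inequality** for a finite product distribution, calibrated so that the
deviation `c √(m a / 2)` has probability at most `exp (-a)`. -/
theorem sum_prod_filter_deviation_le {m : ℕ} (E : Fin m → Type*) [∀ i, Fintype (E i)]
    (ν : ∀ i, E i → ℝ) (hν0 : ∀ i e, 0 ≤ ν i e) (hν1 : ∀ i, ∑ e, ν i e = 1)
    (f : (∀ i, E i) → ℝ) (c : ℝ)
    (hf : ∀ i (ξ ξ' : ∀ i, E i), (∀ j, j ≠ i → ξ j = ξ' j) → |f ξ - f ξ'| ≤ c) (a : ℝ) :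
    ∑ ξ with c * √(m * a / 2) < f ξ - ∑ ξ', (∏ i, ν i (ξ' i)) * f ξ', ∏ i, ν i (ξ i)
      ≤ exp (-a) := by
  have hpos : ∀ ξ : ∀ i, E i, 0 ≤ ∏ i, ν i (ξ i) := fun ξ => prod_nonneg fun i _ => hν0 _ _
  have htot : ∑ ξ : ∀ i, E i, ∏ i, ν i (ξ i) = 1 := by
    rw [← Fintype.piFinset_univ, ← prod_univ_sum]
    simp [hν1]
  set M := ∑ ξ', (∏ i, ν i (ξ' i)) * f ξ' with hM
  have hmgf := sum_prod_mul_exp_sub_mean_le E ν hν0 hν1 f c hf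
  rw [← hM] at hmgf
  rcases le_or_gt a 0 with ha | ha
  · calc _ ≤ ∑ ξ, ∏ i, ν i (ξ i) :=
          sum_le_sum_of_subset_of_nonneg (filter_subset _ _) fun ξ _ _ => hpos ξ
      _ ≤ _ := by rw [htot]; exact one_le_exp (by linarith)
  by_cases hmc : (m : ℝ) * c ^ 2 = 0
  · have h1 := hmgf 1
    have hzero : ∑ ξ, (∏ i, ν i (ξ i)) * (exp (f ξ - M) - (f ξ - M) - 1) = 0 := by
      refine le_antisymm ?_ (sum_nonneg fun ξ _ => mul_nonneg (hpos ξ) ?_)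
      · have : (m : ℝ) * 1 ^ 2 * c ^ 2 / 8 = 0 := by rw [one_pow, mul_one, hmc, zero_div]
        rw [this, exp_zero] at h1
        simp only [mul_sub, sum_sub_distrib, mul_one, htot, ← hM, ← sum_mul, one_mul] at h1 ⊢
        linarith
      · linarith [add_one_le_exp (f ξ - M)]
    rw [sum_eq_zero_iff_of_nonneg fun ξ _ => mul_nonneg (hpos ξ) (by
      linarith [add_one_le_exp (f ξ - M)])] at hzero
    rw [sum_eq_zero]
    · exact (exp_pos _).le
    intro ξ hξ
    rcases mul_eq_zero.1 (hzero ξ (mem_univ _)) with h | h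
    · exact h
    exfalso
    have hz : c * √(m * a / 2) = 0 := by
      rcases mul_eq_zero.1 hmc with h0 | h0
      · simp [h0]
      · simp [pow_eq_zero_iff two_ne_zero |>.1 h0]
    rw [mem_filter, hz] at hξ
    linarith [add_one_lt_exp hξ.2.ne']
  have hm : 0 < m := Nat.pos_of_ne_zero fun h => hmc (by simp [h])
  have hc0 : c ≠ 0 := fun h => hmc (by simp [h])
  have hne : Nonempty (∀ i, E i) := by
    by_contra h
    rw [not_nonempty_iff] at h
    simp at htot
  have hc : 0 < c := lt_of_le_of_ne
    ((abs_nonneg _).trans (hf ⟨0, hm⟩ hne.some hne.some fun _ _ => rfl)) hc0.symm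
  have hm' : (0 : ℝ) < m := by exact_mod_cast hm
  set r := √(m * a / 2) with hr
  have hr2 : r ^ 2 = m * a / 2 := sq_sqrt (by positivity)
  set t := 4 * r / (m * c) with ht
  have ht0 : 0 ≤ t := by positivity
  calc _ ≤ ∑ ξ, (∏ i, ν i (ξ i)) * exp (t * (f ξ - M)) * exp (-(t * (c * r))) := by
        rw [sum_filter]
        refine sum_le_sum fun ξ _ => ?_
        split_ifs with h
        · rw [mul_assoc, ← exp_add]
          refine le_mul_of_one_le_right (hpos ξ) (one_le_exp ?_)
          nlinarith
        · exact mul_nonneg (mul_nonneg (hpos ξ) (exp_pos _).le) (exp_pos _).le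
    _ ≤ exp (m * t ^ 2 * c ^ 2 / 8) * exp (-(t * (c * r))) := by
        rw [← sum_mul]
        exact mul_le_mul_of_nonneg_right (hmgf t) (exp_pos _).le
    _ = exp (-a) := by
        rw [← exp_add]
        congr 1
        have e1 : (m : ℝ) * t ^ 2 * c ^ 2 / 8 = 2 * r ^ 2 / m := by
          rw [ht]; field_simp; ring
        have e2 : t * (c * r) = 4 * r ^ 2 / m := by
          rw [ht]; field_simp
        rw [e1, e2, hr2]
        field_simp
        ring

theorem exp_neg_le_quadratic {x : ℝ} (hx : 0 ≤ x) : exp (-x) ≤ 1 - x + x ^ 2 / 2 := by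
  have h := quadratic_le_exp_of_nonneg hx
  rw [exp_neg, inv_le_iff_one_le_mul₀ (exp_pos x)]
  have h2 : 0 ≤ 1 - x + x ^ 2 / 2 := by nlinarith [sq_nonneg (x - 1)]
  calc (1 : ℝ) ≤ (1 - x + x ^ 2 / 2) * (1 + x + x ^ 2 / 2) := by
        nlinarith [sq_nonneg (x ^ 2)]
    _ ≤ _ := mul_le_mul_of_nonneg_left h h2

/-- Multiplicative **Chernoff bound** for the lower tail of the empirical frequency of `D` in
`n` independent draws from `P`. -/
theorem sum_prod_filter_frequency_le {α : Type*} [Fintype α] (P : α → ℝ) (hP0 : ∀ a, 0 ≤ P a)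
    (hP1 : ∑ a, P a = 1) (n : ℕ) (hn : 0 < n) (D : α → Prop) [DecidablePred D] (b : ℝ) (hb : 0 ≤ b) :
    ∑ s : Fin n → α with √(2 * (∑ a, P a * if D a then 1 else 0) * b / n)
        < (∑ a, P a * if D a then 1 else 0) - 1 / n * ∑ i, if D (s i) then 1 else 0,
      ∏ i, P (s i) ≤ exp (-b) := by
  set p := ∑ a, P a * if D a then (1 : ℝ) else 0 with hp
  have hn' : (0 : ℝ) < n := by exact_mod_cast hn
  have hpos : ∀ s : Fin n → α, 0 ≤ ∏ i, P (s i) := fun s => prod_nonneg fun i _ => hP0 _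
  have hp0 : 0 ≤ p := sum_nonneg fun a _ => mul_nonneg (hP0 a) (by split_ifs <;> norm_num)
  rcases hp0.eq_or_lt with h0 | hp'
  · rw [sum_eq_zero]
    · exact (exp_pos _).le
    intro s hs
    exfalso
    rw [mem_filter, ← h0] at hs
    have h1 : 0 ≤ 1 / (n : ℝ) * ∑ i, if D (s i) then (1 : ℝ) else 0 :=
      mul_nonneg (by positivity) (sum_nonneg fun i _ => by split_ifs <;> norm_num)
    have h2 := hs.2
    simp only [mul_zero, zero_mul, zero_div, sqrt_zero] at h2
    linarith
  set r := √(2 * p * b / n) with hr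
  have hr0 : 0 ≤ r := sqrt_nonneg _
  have hr2 : r ^ 2 = 2 * p * b / n := sq_sqrt (by positivity)
  set t := r / p with ht
  have ht0 : 0 ≤ t := by positivity
  have hone : ∑ a, P a * exp (-(t * if D a then 1 else 0)) ≤ exp (p * (-t + t ^ 2 / 2)) := by
    calc _ ≤ ∑ a, (P a + (P a * if D a then 1 else 0) * (-t + t ^ 2 / 2)) := by
          refine sum_le_sum fun a _ => ?_
          split_ifs
          · have := mul_le_mul_of_nonneg_left (exp_neg_le_quadratic ht0) (hP0 a)
            simp only [mul_one]
            linarith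
          · simp
      _ = p * (-t + t ^ 2 / 2) + 1 := by
          rw [sum_add_distrib, hP1, ← sum_mul, add_comm]
      _ ≤ _ := add_one_le_exp _
  calc _ ≤ ∑ s : Fin n → α, (∏ i, P (s i) * exp (-(t * if D (s i) then 1 else 0))) *
          exp (n * t * (p - r)) := by
        rw [sum_filter]
        refine sum_le_sum fun s _ => ?_
        split_ifs with h
        · rw [prod_mul_distrib, ← exp_sum, mul_assoc, ← exp_add]
          refine le_mul_of_one_le_right (hpos s) (one_le_exp ?_)
          rw [sum_neg_distrib, ← mul_sum]
          set N := ∑ i, if D (s i) then (1 : ℝ) else 0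
          have h3 : N ≤ n * (p - r) := by
            have h4 : 1 / (n : ℝ) * N ≤ p - r := by linarith
            rw [one_div, inv_mul_le_iff₀ hn'] at h4
            exact h4
          nlinarith [mul_le_mul_of_nonneg_left h3 ht0]
        · exact mul_nonneg (prod_nonneg fun i _ => mul_nonneg (hP0 _) (exp_pos _).le)
            (exp_pos _).le
    _ = (∑ a, P a * exp (-(t * if D a then 1 else 0))) ^ n * exp (n * t * (p - r)) := by
        rw [← sum_mul, Fintype.sum_pow]
    _ ≤ exp (p * (-t + t ^ 2 / 2)) ^ n * exp (n * t * (p - r)) := by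
        refine mul_le_mul_of_nonneg_right (pow_le_pow_left₀ (sum_nonneg fun a _ =>
          mul_nonneg (hP0 a) (exp_pos _).le) hone n) (exp_pos _).le
    _ = exp (-b) := by
        rw [← exp_nat_mul, ← exp_add]
        congr 1
        have e : n * (p * (-t + t ^ 2 / 2)) + n * t * (p - r) = -(n * r ^ 2 / (2 * p)) := by
          rw [ht]; field_simp; ring
        rw [e, hr2]
        field_simp

theorem entB_nonneg {α : Type*} [Fintype α] {b : ℝ} (hb : 1 < b) (p : α → ℝ)
    (hp0 : ∀ a, 0 ≤ p a) (hp1 : ∀ a, p a ≤ 1) : 0 ≤ entB b p := by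
  rw [entB, ← sum_neg_distrib]
  refine sum_nonneg fun a _ => ?_
  rw [← mul_neg]
  exact mul_nonneg (hp0 a) (neg_nonneg.2 (Real.logb_nonpos hb (hp0 a) (hp1 a)))

/-- The exponential moment `E[p(q)^{-lam}]` is at least `2^{lam H(p)}`. -/
theorem one_le_two_rpow_neg_entB_mul_sum {ι : Type*} [Fintype ι] (M : Finset ι) (p : ι → ℝ)
    (hp0 : ∀ q, 0 ≤ p q) (hp1 : ∑ q, p q = 1) (hM : ∀ q, q ∉ M → p q = 0) (lam : ℝ) :
    1 ≤ (2 : ℝ) ^ (-(lam * entB 2 p)) * ∑ q ∈ M with 0 < p q, p q ^ (1 - lam) := by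
  have hlog : (0 : ℝ) < Real.log 2 := Real.log_pos one_lt_two
  have hset : ∑ q ∈ M with 0 < p q, p q ^ (1 - lam) = ∑ q with 0 < p q, p q ^ (1 - lam) := by
    congr 1
    ext q
    simp only [mem_filter, mem_univ, true_and, and_iff_right_iff_imp]
    intro hq
    by_contra h
    exact hq.ne' (hM q h)
  rw [hset, mul_sum, sum_filter]
  have hent : entB 2 p * Real.log 2 = -∑ q, p q * Real.log (p q) := by
    rw [entB, neg_mul, sum_mul]
    congr 1
    refine sum_congr rfl fun q _ => ?_
    rw [Real.logb]
    field_simp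
  calc (1 : ℝ) = ∑ q, p q * (-(lam * entB 2 p) * Real.log 2 + -lam * Real.log (p q) + 1) := by
        simp only [mul_add, sum_add_distrib, mul_one, ← sum_mul, hp1, one_mul]
        have : ∑ q, p q * (-lam * Real.log (p q)) = lam * -∑ q, p q * Real.log (p q) := by
          rw [← sum_neg_distrib, mul_sum]
          exact sum_congr rfl fun q _ => by ring
        rw [this, ← hent]
        ring
    _ ≤ _ := by
        refine sum_le_sum fun q _ => ?_
        split_ifs with h
        · rw [rpow_def_of_pos two_pos, rpow_sub h, rpow_one, div_eq_mul_inv, ← rpow_neg h.le,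
            rpow_def_of_pos h, mul_left_comm, ← exp_add]
          refine mul_le_mul_of_nonneg_left ?_ h.le
          refine (add_one_le_exp _).trans (le_of_eq ?_)
          congr 1
          ring
        · rw [le_antisymm (not_lt.1 h) (hp0 q), zero_mul]

/-- A union bound in which each outcome `q` contributes at most `u δ / 2` if it is likely and its
whole mass otherwise. -/
theorem sum_min_le_of_rpow_mul_sum_le {ι : Type*} (M : Finset ι) (p : ι → ℝ)
    (hp0 : ∀ q, 0 ≤ p q) (hp1 : ∑ q ∈ M, p q ≤ 1) (lam δ u : ℝ) (hlam : 0 < lam)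
    (hδ0 : 0 < δ) (hδ1 : δ < 1) (hu : 0 < u)
    (h : u ^ lam * ∑ q ∈ M with 0 < p q, p q ^ (1 - lam) ≤ δ) :
    ∑ q ∈ M, min (p q) (u * δ / 2) ≤ δ := by
  have hmin : ∑ q ∈ M, min (p q) (u * δ / 2) = ∑ q ∈ M with 0 < p q, min (p q) (u * δ / 2) := by
    rw [sum_filter]
    refine sum_congr rfl fun q _ => ?_
    split_ifs with hq
    · rfl
    · rw [le_antisymm (not_lt.1 hq) (hp0 q), min_eq_left (by positivity)]
  have hw : ∀ q, 0 < p q → u ^ lam * p q ^ (1 - lam) = p q * (u / p q) ^ lam := by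
    intro q hq
    rw [rpow_sub hq, rpow_one, div_rpow hu.le hq.le]
    ring
  have hw' : ∀ q, 0 < p q → u ^ lam * p q ^ (1 - lam) = u * (p q / u) ^ (1 - lam) := by
    intro q hq
    rw [div_rpow hq.le hu.le, rpow_sub hu, rpow_one]
    field_simp
  rw [hmin]
  rw [mul_sum] at h
  rcases le_or_gt lam 1 with h1 | h1
  · refine (sum_le_sum fun q hq => ?_).trans h
    have hq := (mem_filter.1 hq).2
    rcases le_or_gt u (p q) with hup | hup
    · rw [hw' q hq]
      have : 1 ≤ (p q / u) ^ (1 - lam) :=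
        one_le_rpow ((one_le_div hu).2 hup) (by linarith)
      refine (min_le_right _ _).trans ?_
      nlinarith
    · rw [hw q hq]
      exact (min_le_left _ _).trans (le_mul_of_one_le_right hq.le
        (one_le_rpow ((one_le_div hq).2 hup.le) hlam.le))
  · have hsum : ∑ q ∈ M with 0 < p q, p q ≤ 1 :=
      (sum_le_sum_of_subset_of_nonneg (filter_subset _ _) fun q _ _ => hp0 q).trans hp1
    calc _ ≤ ∑ q ∈ M with 0 < p q, (δ / 2 * p q + δ / 2 * (u ^ lam * p q ^ (1 - lam))) := by
          refine sum_le_sum fun q hq => ?_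
          have hq := (mem_filter.1 hq).2
          have hnn : 0 ≤ u ^ lam * p q ^ (1 - lam) := by positivity
          refine (min_le_right _ _).trans ?_
          rcases le_or_gt u (p q) with hup | hup
          · nlinarith
          · have : 1 ≤ (p q / u) ^ (1 - lam) :=
              one_le_rpow_of_pos_of_le_one_of_nonpos (by positivity)
                ((div_le_one hu).2 hup.le) (by linarith)
            have h2 : u ≤ u ^ lam * p q ^ (1 - lam) := by
              rw [hw' q hq]
              nlinarith
            nlinarith
      _ ≤ δ := by
          rw [sum_add_distrib, ← mul_sum, ← mul_sum]
          nlinarith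

theorem sum_sqrt_le_sqrt_card_mul_sqrt_sum {ι : Type*} [Fintype ι] (v : ι → ℝ)
    (hv : ∀ i, 0 ≤ v i) : ∑ i, √(v i) ≤ √(Fintype.card ι) * √(∑ i, v i) := by
  rw [← sqrt_mul (Nat.cast_nonneg _)]
  refine le_sqrt_of_sq_le (sq_sum_le_card_mul_sum_sq.trans (le_of_eq ?_))
  simp [sq_sqrt (hv _)]

/-- The probability that the empirical frequency of some cell `(y, z)` with `z ∈ T y` falls below
its expectation by more than the Chernoff deviation. -/
theorem sum_prod_filter_exists_frequency_le {𝒳 𝒴 𝒵 : Type*} [Fintype 𝒳] [Fintype 𝒴]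
    [DecidableEq 𝒴] [DecidableEq 𝒵]
    (P : 𝒳 × 𝒴 → ℝ) (hP0 : ∀ a, 0 ≤ P a) (hP1 : ∑ a, P a = 1) (n : ℕ) (hn : 0 < n)
    (φ : 𝒳 → 𝒵) (T : 𝒴 → Finset 𝒵) (b : 𝒴 → ℝ) (hb : ∀ y, 0 ≤ b y) :
    ∑ s : Fin n → 𝒳 × 𝒴 with ∃ y, ∃ z ∈ T y,
        √(2 * (∑ a, P a * if a.2 = y ∧ φ a.1 = z then 1 else 0) * b y / n)
          < (∑ a, P a * if a.2 = y ∧ φ a.1 = z then 1 else 0)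
            - 1 / n * ∑ i, if (s i).2 = y ∧ φ (s i).1 = z then 1 else 0,
      ∏ i, P (s i) ≤ ∑ y, ∑ _z ∈ T y, exp (-b y) := by
  have hpos : ∀ s : Fin n → 𝒳 × 𝒴, 0 ≤ ∏ i, P (s i) := fun s => prod_nonneg fun i _ => hP0 _
  refine le_trans ?_ (sum_le_sum fun y _ => sum_le_sum fun z _ =>
    sum_prod_filter_frequency_le P hP0 hP1 n hn (fun a => a.2 = y ∧ φ a.1 = z) (b y) (hb y))
  simp only [sum_filter]
  simp_rw [sum_comm (s := T _) (t := univ (α := Fin n → 𝒳 × 𝒴))]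
  rw [sum_comm]
  refine sum_le_sum fun s _ => ?_
  have hnn : ∀ (C : Prop) [Decidable C], 0 ≤ if C then ∏ i, P (s i) else 0 := by
    intro C _
    split_ifs
    exacts [hpos s, le_rfl]
  by_cases h : ∃ y, ∃ z ∈ T y,
      √(2 * (∑ a, P a * if a.2 = y ∧ φ a.1 = z then 1 else 0) * b y / n)
        < (∑ a, P a * if a.2 = y ∧ φ a.1 = z then 1 else 0)
          - 1 / n * ∑ i, if (s i).2 = y ∧ φ (s i).1 = z then 1 else 0
  · rw [if_pos h]
    obtain ⟨y, z, hz, h⟩ := h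
    refine le_trans ?_ (single_le_sum (fun y _ => sum_nonneg fun z _ => hnn _) (mem_univ y))
    refine le_trans ?_ (single_le_sum (fun z _ => hnn _) hz)
    rw [if_pos h]
  · rw [if_neg h]
    exact sum_nonneg fun y _ => sum_nonneg fun z _ => hnn _

/-- Generalization gap of a model that factors through an encoder `φ`, on a sample for which no
cell `(y, z)` with `z ∈ T y` is under-represented. -/
theorem generalization_gap_le {𝒳 𝒴 𝒵 : Type*} [Fintype 𝒳] [Fintype 𝒴] [Fintype 𝒵] [Nonempty 𝒴]
    [DecidableEq 𝒴] [DecidableEq 𝒵]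
    (P : 𝒳 × 𝒴 → ℝ) (hP0 : ∀ a, 0 ≤ P a) (n : ℕ) (φ : 𝒳 → 𝒵) (F : 𝒵 → 𝒴 → ℝ)
    (hF : ∀ z y, 0 ≤ F z y) (s : Fin n → 𝒳 × 𝒴) (pY : 𝒴 → ℝ) (hpY0 : ∀ y, 0 ≤ pY y)
    (hpY1 : ∑ y, pY y = 1) (pZ : 𝒴 → 𝒵 → ℝ)
    (hjoint : ∀ y z, ∑ a, P a * (if a.2 = y ∧ φ a.1 = z then 1 else 0) = pY y * pZ y z)
    (T : 𝒴 → Finset 𝒵) (b : 𝒴 → ℝ) (hb : ∀ y, 0 ≤ b y) (τ R G : ℝ)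
    (hτ : ∀ y, ∑ z with z ∉ T y, pZ y z ≤ τ) (hR0 : 0 ≤ R) (hR : ∀ x y, F (φ x) y ≤ R)
    (hG : ∀ y, ∑ z ∈ T y, F z y * √(2 * Fintype.card 𝒴 * pZ y z) ≤ G)
    (hgood : ∀ y, ∀ z ∈ T y,
      (∑ a, P a * if a.2 = y ∧ φ a.1 = z then 1 else 0)
          - 1 / n * (∑ i, if (s i).2 = y ∧ φ (s i).1 = z then 1 else 0)
        ≤ √(2 * (∑ a, P a * if a.2 = y ∧ φ a.1 = z then 1 else 0) * b y / n)) :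
    (∑ a, P a * F (φ a.1) a.2) - 1 / n * ∑ i, F (φ (s i).1) (s i).2
      ≤ G * √((∑ y, pY y * b y) / n) + τ * R := by
  have hind : ∀ a : 𝒳 × 𝒴, F (φ a.1) a.2 =
      ∑ y, ∑ z, F z y * if a.2 = y ∧ φ a.1 = z then 1 else 0 := by
    intro a
    simp [ite_and]
  have hmass : ∑ a, P a * F (φ a.1) a.2 =
      ∑ y, ∑ z, F z y * ∑ a, P a * if a.2 = y ∧ φ a.1 = z then 1 else 0 := by
    simp_rw [hind, mul_sum]
    rw [sum_comm]
    refine sum_congr rfl fun y _ => ?_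
    rw [sum_comm]
    exact sum_congr rfl fun z _ => sum_congr rfl fun a _ => by ring
  have hemp : 1 / (n : ℝ) * ∑ i, F (φ (s i).1) (s i).2 =
      ∑ y, ∑ z, F z y * (1 / n * ∑ i, if (s i).2 = y ∧ φ (s i).1 = z then 1 else 0) := by
    simp_rw [hind (s _), mul_sum]
    rw [sum_comm]
    refine sum_congr rfl fun y _ => ?_
    rw [sum_comm]
    exact sum_congr rfl fun z _ => sum_congr rfl fun a _ => by ring
  have hcell : ∀ y z, F z y * (pY y * pZ y z) ≤ R * (pY y * pZ y z) := by
    intro y z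
    rw [← hjoint, mul_sum, mul_sum]
    refine sum_le_sum fun a _ => ?_
    split_ifs with h
    · rw [← h.1, ← h.2]
      exact mul_le_mul_of_nonneg_right (hR _ _) (mul_nonneg (hP0 a) zero_le_one)
    · simp
  have hcard : (0 : ℝ) < √(Fintype.card 𝒴) :=
    sqrt_pos.2 (by exact_mod_cast Fintype.card_pos)
  have hv : ∀ y, 0 ≤ pY y * b y / n := fun y =>
    div_nonneg (mul_nonneg (hpY0 y) (hb y)) (Nat.cast_nonneg _)
  have htyp : ∑ y, ∑ z ∈ T y, F z y * √(2 * (pY y * pZ y z) * b y / n)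
      ≤ G * √((∑ y, pY y * b y) / n) := by
    have hG0 : 0 ≤ G := (sum_nonneg fun z _ => mul_nonneg (hF _ _) (sqrt_nonneg _)).trans
      (hG (Classical.arbitrary 𝒴))
    calc _ ≤ ∑ y, G / √(Fintype.card 𝒴) * √(pY y * b y / n) := by
          refine sum_le_sum fun y _ => ?_
          calc _ = (∑ z ∈ T y, F z y * √(2 * Fintype.card 𝒴 * pZ y z)) / √(Fintype.card 𝒴)
                  * √(pY y * b y / n) := by
                rw [sum_div, sum_mul]
                refine sum_congr rfl fun z _ => ?_
                have e1 : 2 * (pY y * pZ y z) * b y / n = pY y * b y / n * (2 * pZ y z) := by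
                  ring
                have e2 : 2 * (Fintype.card 𝒴 : ℝ) * pZ y z
                    = Fintype.card 𝒴 * (2 * pZ y z) := by ring
                rw [e1, e2, sqrt_mul (hv y), sqrt_mul (Nat.cast_nonneg _)]
                field_simp
            _ ≤ _ := mul_le_mul_of_nonneg_right
                (div_le_div_of_nonneg_right (hG y) hcard.le) (sqrt_nonneg _)
      _ = G / √(Fintype.card 𝒴) * ∑ y, √(pY y * b y / n) := by rw [mul_sum]
      _ ≤ G / √(Fintype.card 𝒴) * (√(Fintype.card 𝒴) * √(∑ y, pY y * b y / n)) :=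
          mul_le_mul_of_nonneg_left (sum_sqrt_le_sqrt_card_mul_sqrt_sum _ hv)
            (div_nonneg hG0 hcard.le)
      _ = _ := by
          rw [← sum_div]
          field_simp
  have hatyp : ∑ y, ∑ z with z ∉ T y, F z y * (pY y * pZ y z) ≤ τ * R := by
    calc _ ≤ ∑ y, pY y * (τ * R) := by
          refine sum_le_sum fun y _ => ?_
          calc _ ≤ ∑ z with z ∉ T y, R * (pY y * pZ y z) := sum_le_sum fun z _ => hcell y z
            _ = pY y * ((∑ z with z ∉ T y, pZ y z) * R) := by
                rw [sum_mul, mul_sum]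
                exact sum_congr rfl fun z _ => by ring
            _ ≤ _ := mul_le_mul_of_nonneg_left
                (mul_le_mul_of_nonneg_right (hτ y) hR0) (hpY0 y)
      _ = _ := by rw [← sum_mul, hpY1, one_mul]
  rw [hmass, hemp, ← sum_sub_distrib]
  refine le_trans ?_ (add_le_add htyp hatyp)
  rw [← sum_add_distrib]
  refine sum_le_sum fun y _ => ?_
  rw [← sum_sub_distrib, ← sum_filter_add_sum_filter_not univ (fun z => z ∈ T y)]
  refine add_le_add ?_ ?_
  · rw [filter_mem_eq_inter, univ_inter]
    refine sum_le_sum fun z hz => ?_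
    rw [← mul_sub, ← hjoint]
    exact mul_le_mul_of_nonneg_left (hgood y z hz) (hF z y)
  · refine sum_le_sum fun z _ => ?_
    rw [hjoint, sub_le_self_iff]
    exact mul_nonneg (hF z y) (mul_nonneg (by positivity)
      (sum_nonneg fun i _ => by split_ifs <;> norm_num))

/-- Main Theorem, learned encoder, single layer: the encoder
`φˢ = A(s)` belongs to a finite family `ℳ`; with probability at least `1 − δ` over
`s ~ P^{⊗n}`,
`Δ(s) ≤ G₃·√(((I(X;Zˢ|Y) + I(φˢ;S) + G₂ + G₄)·ln2 + ln(4|𝒴|/δ))/n) + G₁(q̃)/√n`,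
where `C_λ = 2^{−λH(φˢ)}·Σ_{q, P(φˢ=q)>0} P(φˢ=q)^{1−λ}`,
`G₄ = (1/λ)·log₂(C_λ/δ) + H(φˢ|S)`, `q̃ = (I(φˢ;S)+G₄)·ln2 + ln2`, and
`G₁(q) = ℒ(fˢ,s)·√(2γ|𝒴|)·√(q + ln(2|𝒴|/δ))/n^{1/4} + γ·ℛ(fˢ)`. -/
theorem ib_learned_encoder_generalization_bound
    {𝒳 𝒴 𝒵 : Type*} [Fintype 𝒳] [Fintype 𝒴] [Fintype 𝒵]
    [Nonempty 𝒳] [Nonempty 𝒴] [DecidableEq 𝒳] [DecidableEq 𝒵]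
    -- data distribution P over 𝒳 × 𝒴 and its 𝒴-marginal
    (P : 𝒳 × 𝒴 → ℝ) (hP0 : ∀ a, 0 ≤ P a) (hP1 : ∑ a, P a = 1)
    (pY : 𝒴 → ℝ) (hpY : ∀ y, pY y = ∑ x, P (x, y))
    -- generative structure: given Y = y, X = χ(y, Ξ_y) with Ξ_y having m mutually
    -- independent finite-valued coordinates, coordinate i distributed as ν y i
    (m : ℕ) (E : Fin m → Type*) [∀ i, Fintype (E i)]
    (ν : 𝒴 → ∀ i, E i → ℝ) (hν0 : ∀ y i e, 0 ≤ ν y i e) (hν1 : ∀ y i, ∑ e, ν y i e = 1)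
    (χ : 𝒴 → (∀ i, E i) → 𝒳)
    (PΞ : 𝒴 → (∀ i, E i) → ℝ) (hPΞ : ∀ y ξ, PΞ y ξ = ∏ i, ν y i (ξ i))
    (pXy : 𝒴 → 𝒳 → ℝ)
    (hpXy : ∀ y x, pXy y x = ∑ ξ ∈ univ.filter (fun ξ => χ y ξ = x), PΞ y ξ)
    (hgen : ∀ x y, P (x, y) = pY y * pXy y x)
    -- sample size and parameters
    (n : ℕ) (hn : 0 < n) (γ δ lam : ℝ) (hγ : 0 < γ) (hδ0 : 0 < δ) (hδ1 : δ < 1)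
    (hlam : 0 < lam)
    -- learning algorithm: encoder φˢ = A(s) ∈ ℳ and decoder gˢ = B(s)
    {my : ℕ} (ℳ : Finset (𝒳 → 𝒵))
    (A : (Fin n → 𝒳 × 𝒴) → 𝒳 → 𝒵) (hA : ∀ s, A s ∈ ℳ)
    (B : (Fin n → 𝒳 × 𝒴) → 𝒵 → Fin my → ℝ)
    (ℓ : (Fin my → ℝ) → 𝒴 → ℝ) (hℓ0 : ∀ q y, 0 ≤ ℓ q y)
    -- conditional law of Zˢ = φˢ(X) given Y = y; positivity on attainable points
    (pZy : (Fin n → 𝒳 × 𝒴) → 𝒴 → 𝒵 → ℝ)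
    (hpZy : ∀ s y z, pZy s y z = ∑ ξ ∈ univ.filter (fun ξ => A s (χ y ξ) = z), PΞ y ξ)
    (hpos : ∀ s y ξ, 0 < pZy s y (A s (χ y ξ)))
    (HZy : (Fin n → 𝒳 × 𝒴) → 𝒴 → ℝ) (hHZy : ∀ s y, HZy s y = entB 2 (pZy s y))
    -- sensitivity of the learned encoder w.r.t. each nuisance coordinate
    (c : (Fin n → 𝒳 × 𝒴) → 𝒴 → ℝ)
    (hsens : ∀ s y (i : Fin m) (ξ ξ' : ∀ i, E i), (∀ j, j ≠ i → ξ j = ξ' j) →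
      |Real.logb 2 (pZy s y (A s (χ y ξ))) - Real.logb 2 (pZy s y (A s (χ y ξ')))| ≤ c s y)
    -- typical sets 𝒵_{γ,y} and the data-dependent constants of the bound
    (εy : (Fin n → 𝒳 × 𝒴) → 𝒴 → ℝ)
    (hεy : ∀ s y, εy s y = c s y * Real.sqrt (m * Real.log (Real.sqrt n / γ) / 2))
    (Ztyp : (Fin n → 𝒳 × 𝒴) → 𝒴 → Finset 𝒵)
    (hZtyp : ∀ s y, Ztyp s y =
      univ.filter (fun z => 0 < pZy s y z ∧ -Real.logb 2 (pZy s y z) - HZy s y ≤ εy s y))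
    (G₂ : (Fin n → 𝒳 × 𝒴) → ℝ)
    (hG₂ : ∀ s, G₂ s = (∑ y, pY y * c s y) * Real.sqrt (m * Real.log (Real.sqrt n / γ) / 2))
    (G₃ : (Fin n → 𝒳 × 𝒴) → ℝ)
    (hG₃ : ∀ s, G₃ s = univ.sup' univ_nonempty (fun y =>
      ∑ z ∈ Ztyp s y, ℓ (B s z) y * Real.sqrt (2 * (Fintype.card 𝒴) * pZy s y z)))
    -- conditional mutual information I(X;Zˢ|Y), with base-2 logarithms
    (IXZY : (Fin n → 𝒳 × 𝒴) → ℝ)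
    (hIXZY : ∀ s, IXZY s = ∑ y, pY y *
      (entB 2 (pXy y) + entB 2 (pZy s y)
        - entB 2 (fun xz : 𝒳 × 𝒵 => if A s xz.1 = xz.2 then pXy y xz.1 else 0)))
    -- law of the dataset S ~ P^{⊗n}, of the learned encoder φˢ, and their joint law
    (Pn : (Fin n → 𝒳 × 𝒴) → ℝ) (hPn : ∀ s, Pn s = ∏ i, P (s i))
    (pφ : (𝒳 → 𝒵) → ℝ)
    (hpφ : ∀ q, pφ q = ∑ s ∈ univ.filter (fun s => A s = q), Pn s)
    (pJoint : (Fin n → 𝒳 × 𝒴) × (𝒳 → 𝒵) → ℝ)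
    (hpJoint : ∀ s q, pJoint (s, q) = if A s = q then Pn s else 0)
    -- I(φˢ;S), H(φˢ|S), C_λ, G₄ and q̃
    (Iφ Hφcond Clam G₄ qt : ℝ)
    (hIφ : Iφ = entB 2 pφ + entB 2 Pn - entB 2 pJoint)
    (hHφcond : Hφcond = entB 2 pJoint - entB 2 Pn)
    (hClam : Clam = 2 ^ (-(lam * entB 2 pφ)) *
      ∑ q ∈ ℳ.filter (fun q => 0 < pφ q), pφ q ^ (1 - lam))
    (hG₄ : G₄ = (1 / lam) * Real.logb 2 (Clam / δ) + Hφcond)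
    (hqt : qt = (Iφ + G₄) * Real.log 2 + Real.log 2)
    -- supremum loss ℛ(fˢ), empirical maximum loss ℒ(fˢ,s), gap Δ(s), and G₁
    (ℛ : (Fin n → 𝒳 × 𝒴) → ℝ)
    (hℛ : ∀ s, ℛ s = univ.sup' univ_nonempty (fun a : 𝒳 × 𝒴 => ℓ (B s (A s a.1)) a.2))
    (Δ L : (Fin n → 𝒳 × 𝒴) → ℝ) (G₁ : (Fin n → 𝒳 × 𝒴) → ℝ → ℝ)
    (hΔ : ∀ s, Δ s = (∑ a : 𝒳 × 𝒴, P a * ℓ (B s (A s a.1)) a.2)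
      - (1 / n) * ∑ i, ℓ (B s (A s (s i).1)) (s i).2)
    (hL : ∀ s, L s = ⨆ i : Fin n, ℓ (B s (A s (s i).1)) (s i).2)
    (hG₁ : ∀ s q, G₁ s q = L s * Real.sqrt (2 * γ * (Fintype.card 𝒴))
        * Real.sqrt (q + Real.log (2 * (Fintype.card 𝒴) / δ)) / (n : ℝ) ^ ((1 : ℝ) / 4)
      + γ * ℛ s) :
    1 - δ ≤ ∑ s ∈ univ.filter (fun s : Fin n → 𝒳 × 𝒴 =>
      Δ s ≤ G₃ s * Real.sqrt (((IXZY s + Iφ + G₂ s + G₄) * Real.log 2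
          + Real.log (4 * (Fintype.card 𝒴) / δ)) / n)
        + G₁ s qt / Real.sqrt n), Pn s := by
  have hn' : (0 : ℝ) < n := by exact_mod_cast hn
  have hlog2 : (0 : ℝ) < Real.log 2 := Real.log_pos one_lt_two
  have hPΞ0 : ∀ y ξ, 0 ≤ PΞ y ξ := fun y ξ => by
    rw [hPΞ]
    exact prod_nonneg fun i _ => hν0 y i _
  have hPΞ1 : ∀ y, ∑ ξ, PΞ y ξ = 1 := fun y => by
    simp_rw [hPΞ]
    rw [← Fintype.piFinset_univ, ← prod_univ_sum]
    simp [hν1]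
  have hpush : ∀ s y (h : 𝒵 → ℝ),
      ∑ z, pZy s y z * h z = ∑ ξ, PΞ y ξ * h (A s (χ y ξ)) := by
    intro s y h
    rw [← sum_fiberwise univ (fun ξ => A s (χ y ξ))]
    refine sum_congr rfl fun z _ => ?_
    rw [hpZy, sum_mul]
    exact sum_congr rfl fun ξ hξ => by rw [(mem_filter.1 hξ).2]
  have hpushX : ∀ y (h : 𝒳 → ℝ), ∑ x, pXy y x * h x = ∑ ξ, PΞ y ξ * h (χ y ξ) := by
    intro y h
    rw [← sum_fiberwise univ (fun ξ => χ y ξ)]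
    refine sum_congr rfl fun x _ => ?_
    rw [hpXy, sum_mul]
    exact sum_congr rfl fun ξ hξ => by rw [(mem_filter.1 hξ).2]
  have hpZ0 : ∀ s y z, 0 ≤ pZy s y z := fun s y z => by
    rw [hpZy]
    exact sum_nonneg fun ξ _ => hPΞ0 y ξ
  have hpZ1 : ∀ s y, ∑ z, pZy s y z = 1 := fun s y => by
    simpa [hPΞ1] using hpush s y fun _ => 1
  have hpY0 : ∀ y, 0 ≤ pY y := fun y => by
    rw [hpY]
    exact sum_nonneg fun x _ => hP0 _
  have hpY1 : ∑ y, pY y = 1 := by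
    simp_rw [hpY]
    rw [← hP1, Fintype.sum_prod_type_right]
  have hjoint : ∀ s y z,
      ∑ a, P a * (if a.2 = y ∧ A s a.1 = z then 1 else 0) = pY y * pZy s y z := by
    intro s y z
    have h1 := hpushX y fun x => if A s x = z then 1 else 0
    have h2 := hpush s y fun z' => if z' = z then 1 else 0
    rw [← h2] at h1
    simp only [mul_ite, mul_one, mul_zero, sum_ite_eq', mem_univ, if_true] at h1
    rw [← h1, Fintype.sum_prod_type_right, mul_sum]
    simp only [ite_and, mul_ite, mul_one, mul_zero]
    rw [sum_comm]
    refine sum_congr rfl fun x _ => ?_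
    rw [sum_ite_eq' univ y]
    simp [hgen]
  have hHZ0 : ∀ s y, 0 ≤ HZy s y := fun s y => by
    rw [hHZy]
    refine entB_nonneg one_lt_two _ (hpZ0 s y) fun z => ?_
    rw [← hpZ1 s y]
    exact single_le_sum (fun z _ => hpZ0 s y z) (mem_univ z)
  have hIX : ∀ s, IXZY s = ∑ y, pY y * HZy s y := by
    intro s
    rw [hIXZY]
    refine sum_congr rfl fun y _ => ?_
    have : entB 2 (fun xz : 𝒳 × 𝒵 => if A s xz.1 = xz.2 then pXy y xz.1 else 0)
        = entB 2 (pXy y) := by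
      rw [entB, entB, Fintype.sum_prod_type]
      congr 1
      refine sum_congr rfl fun x _ => ?_
      rw [sum_eq_single (A s x)]
      · simp
      · intro z _ hz
        simp [hz.symm]
      · simp
    rw [this, hHZy]
    ring
  have hε0 : ∀ s y, 0 ≤ εy s y := by
    intro s y
    rw [hεy]
    rcases Nat.eq_zero_or_pos m with hm | hm
    · simp [hm]
    · refine mul_nonneg ?_ (sqrt_nonneg _)
      have hne : Nonempty (∀ i, E i) := by
        by_contra h
        rw [not_nonempty_iff] at h
        simpa using hPΞ1 y
      exact (abs_nonneg _).trans (hsens s y ⟨0, hm⟩ hne.some hne.some fun _ _ => rfl)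
  have hatyp : ∀ s y, ∑ z with z ∉ Ztyp s y, pZy s y z ≤ γ / √n := by
    intro s y
    have hmc := sum_prod_filter_deviation_le E (ν y) (hν0 y) (hν1 y)
      (fun ξ => -Real.logb 2 (pZy s y (A s (χ y ξ)))) (c s y) (fun i ξ ξ' h => by
        rw [neg_sub_neg, abs_sub_comm]
        exact hsens s y i ξ ξ' h) (Real.log (√n / γ))
    simp_rw [← hPΞ] at hmc
    rw [← hpush s y fun z => -Real.logb 2 (pZy s y z), ← hεy, exp_neg,
      exp_log (div_pos (sqrt_pos.2 hn') hγ), inv_div] at hmc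
    have hH : ∑ z, pZy s y z * -Real.logb 2 (pZy s y z) = HZy s y := by
      rw [hHZy, entB, ← sum_neg_distrib]
      exact sum_congr rfl fun z _ => by ring
    rw [hH] at hmc
    refine le_trans (le_of_eq ?_) hmc
    have h := hpush s y fun z => if z ∉ Ztyp s y then 1 else 0
    simp only [mul_ite, mul_one, mul_zero] at h
    rw [sum_filter, h, sum_filter]
    refine sum_congr rfl fun ξ _ => ?_
    simp only [hZtyp, mem_filter, mem_univ, true_and, hpos, not_le]
  have hpφ0 : ∀ q, 0 ≤ pφ q := fun q => by
    rw [hpφ]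
    exact sum_nonneg fun s _ => by rw [hPn]; exact prod_nonneg fun i _ => hP0 _
  have hPn0 : ∀ s, 0 ≤ Pn s := fun s => by
    rw [hPn]
    exact prod_nonneg fun i _ => hP0 _
  have hPn1 : ∑ s, Pn s = 1 := by
    simp_rw [hPn]
    rw [← Fintype.sum_pow, hP1, one_pow]
  have hpφ1 : ∑ q, pφ q = 1 := by
    simp_rw [hpφ]
    rw [← hPn1]
    convert sum_fiberwise univ A Pn
  have hpφM : ∀ q, q ∉ ℳ → pφ q = 0 := fun q hq => by
    rw [hpφ]
    refine sum_eq_zero fun s hs => ?_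
    exact absurd ((mem_filter.1 hs).2 ▸ hA s) hq
  have hC1 : 1 ≤ Clam := by
    rw [hClam]
    exact one_le_two_rpow_neg_entB_mul_sum ℳ pφ hpφ0 hpφ1 hpφM lam
  set K := Iφ + G₄ with hK
  have hK' : K = entB 2 pφ + 1 / lam * Real.logb 2 (Clam / δ) := by
    rw [hK, hG₄, hIφ, hHφcond]
    ring
  have hCδ : 1 ≤ Clam / δ := (one_le_div hδ0).2 (hδ1.le.trans hC1)
  have hK0 : 0 ≤ K := by
    rw [hK']
    refine add_nonneg (entB_nonneg one_lt_two _ hpφ0 fun q => ?_)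
      (mul_nonneg (by positivity) (Real.logb_nonneg one_lt_two hCδ))
    rw [← hpφ1]
    exact single_le_sum (fun q _ => hpφ0 q) (mem_univ q)
  set u : ℝ := 2 ^ (-K) with hu
  have hu0 : 0 < u := by positivity
  have hulam : u ^ lam * ∑ q ∈ ℳ with 0 < pφ q, pφ q ^ (1 - lam) ≤ δ := by
    have e : u ^ lam = 2 ^ (-(lam * entB 2 pφ)) * (Clam / δ)⁻¹ := by
      rw [hu, ← rpow_mul two_pos.le, hK']
      have : -(entB 2 pφ + 1 / lam * Real.logb 2 (Clam / δ)) * lam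
          = -(lam * entB 2 pφ) + -Real.logb 2 (Clam / δ) := by
        field_simp
        ring
      rw [this, rpow_add two_pos, rpow_neg two_pos.le (Real.logb 2 (Clam / δ)),
        rpow_logb two_pos (by norm_num) (by linarith)]
    rw [e, mul_right_comm, ← hClam, inv_div]
    exact le_of_eq (mul_div_cancel₀ _ (by linarith))
  have hY : (1 : ℝ) ≤ Fintype.card 𝒴 := by exact_mod_cast Fintype.card_pos
  set κ := K * Real.log 2 + Real.log (4 * Fintype.card 𝒴 / δ) with hκ
  have hκ0 : 0 ≤ κ := add_nonneg (mul_nonneg hK0 hlog2.le)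
    (Real.log_nonneg ((one_le_div hδ0).2 (by linarith)))
  have hexpκ : Fintype.card 𝒴 * exp (-κ) = u * δ / 4 := by
    rw [hκ, neg_add, exp_add, exp_neg (Real.log _), exp_log (by positivity), hu,
      rpow_def_of_pos two_pos]
    have : Real.log 2 * -K = -(K * Real.log 2) := by ring
    rw [this]
    field_simp
  set bound : (Fin n → 𝒳 × 𝒴) → ℝ := fun s =>
    G₃ s * Real.sqrt (((IXZY s + Iφ + G₂ s + G₄) * Real.log 2
      + Real.log (4 * (Fintype.card 𝒴) / δ)) / n) + G₁ s qt / Real.sqrt n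
  have hfix : ∀ s', ∑ s with A s = A s' ∧ ¬ Δ s ≤ bound s, Pn s ≤ u * δ / 2 := by
    intro s'
    have hmin : ∀ y, ∃ s₀, A s₀ = A s' ∧ ∀ s, A s = A s' → εy s₀ y ≤ εy s y := by
      intro y
      obtain ⟨s₀, h₀, h₁⟩ := exists_min_image (univ.filter fun s => A s = A s')
        (fun s => εy s y) ⟨s', by simp⟩
      exact ⟨s₀, (mem_filter.1 h₀).2, fun s hs => h₁ s (by simp [hs])⟩
    choose s₀ hs₀ hs₀min using hmin
    have hpZeq : ∀ s s'', A s = A s'' → pZy s = pZy s'' := fun s s'' h => by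
      ext y z
      rw [hpZy, hpZy, h]
    have hHeq : ∀ s s'', A s = A s'' → HZy s = HZy s'' := fun s s'' h => by
      ext y
      rw [hHZy, hHZy, hpZeq s s'' h]
    set T : 𝒴 → Finset 𝒵 := fun y => Ztyp (s₀ y) y with hT
    set b : 𝒴 → ℝ := fun y => (HZy s' y + εy (s₀ y) y) * Real.log 2 + κ with hb
    have hb0 : ∀ y, 0 ≤ b y := fun y =>
      add_nonneg (mul_nonneg (add_nonneg (hHZ0 _ _) (hε0 _ _)) hlog2.le) hκ0
    have hbad := sum_prod_filter_exists_frequency_le P hP0 hP1 n hn (A s') T b hb0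
    have hcount : ∑ y, ∑ _z ∈ T y, exp (-b y) ≤ u * δ / 2 := by
      calc _ ≤ ∑ _y : 𝒴, exp (-κ) := by
            refine sum_le_sum fun y _ => ?_
            calc _ ≤ ∑ z ∈ T y, pZy s' y z * exp (-κ) := by
                  refine sum_le_sum fun z hz => ?_
                  rw [hb, neg_add, exp_add]
                  refine mul_le_mul_of_nonneg_right ?_ (exp_pos _).le
                  simp only [hT] at hz
                  rw [hZtyp, hpZeq _ _ (hs₀ y), hHeq _ _ (hs₀ y), mem_filter] at hz
                  obtain ⟨-, hz0, hz⟩ := hz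
                  rw [← le_log_iff_exp_le hz0]
                  have : Real.log (pZy s' y z) = Real.logb 2 (pZy s' y z) * Real.log 2 := by
                    rw [Real.logb]
                    field_simp
                  rw [this]
                  nlinarith
              _ ≤ exp (-κ) := by
                  rw [← sum_mul]
                  refine mul_le_of_le_one_left (exp_pos _).le ?_
                  rw [← hpZ1 s' y]
                  exact sum_le_sum_of_subset_of_nonneg (subset_univ _) fun z _ _ => hpZ0 _ _ _
        _ = u * δ / 4 := by
            rw [sum_const, card_univ, nsmul_eq_mul, hexpκ]
        _ ≤ u * δ / 2 := by nlinarith [mul_pos hu0 hδ0]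
    refine le_trans ?_ (hbad.trans hcount)
    simp_rw [← hPn]
    refine sum_le_sum_of_subset_of_nonneg ?_ fun s _ _ => hPn0 s
    intro s hs
    rw [mem_filter] at hs ⊢
    obtain ⟨-, hAs, hΔs⟩ := hs
    refine ⟨mem_univ _, ?_⟩
    by_contra hgood
    push Not at hgood
    apply hΔs
    rw [← hAs] at hgood
    have hRle : ∀ x y, ℓ (B s (A s x)) y ≤ ℛ s := fun x y => by
      rw [hℛ]
      exact le_sup' (fun a : 𝒳 × 𝒴 => ℓ (B s (A s a.1)) a.2) (mem_univ (x, y))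
    have hR0 : 0 ≤ ℛ s := (hℓ0 _ _).trans
      (hRle (Classical.arbitrary 𝒳) (Classical.arbitrary 𝒴))
    have hTsub : ∀ y, T y ⊆ Ztyp s y := by
      intro y z hz
      simp only [hT] at hz
      rw [hZtyp, hpZeq _ _ ((hs₀ y).trans hAs.symm),
        hHeq _ _ ((hs₀ y).trans hAs.symm)] at hz
      rw [hZtyp]
      rw [mem_filter] at hz ⊢
      exact ⟨hz.1, hz.2.1, hz.2.2.trans (hs₀min y s hAs)⟩
    have hgap := generalization_gap_le P hP0 n (A s) (fun z y => ℓ (B s z) y)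
      (fun z y => hℓ0 _ _) s pY hpY0 hpY1 (pZy s) (hjoint s) T b hb0 (γ / √n) (ℛ s) (G₃ s)
      (fun y => by
        rw [hpZeq s (s₀ y) (hAs.trans (hs₀ y).symm)]
        exact hatyp (s₀ y) y)
      hR0 hRle
      (fun y => by
        rw [hG₃]
        refine le_trans (sum_le_sum_of_subset_of_nonneg (hTsub y) fun z _ _ =>
          mul_nonneg (hℓ0 _ _) (sqrt_nonneg _)) ?_
        exact le_sup' (fun y => ∑ z ∈ Ztyp s y,
          ℓ (B s z) y * Real.sqrt (2 * (Fintype.card 𝒴) * pZy s y z)) (mem_univ y))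
      hgood
    rw [hΔ]
    refine hgap.trans (add_le_add (mul_le_mul_of_nonneg_left (sqrt_le_sqrt
      (div_le_div_of_nonneg_right ?_ hn'.le)) ?_) ?_)
    · have hG2 : G₂ s = ∑ y, pY y * εy s y := by
        rw [hG₂, sum_mul]
        exact sum_congr rfl fun y _ => by rw [hεy]; ring
      calc ∑ y, pY y * b y
          ≤ ∑ y, (pY y * HZy s y * Real.log 2 + pY y * εy s y * Real.log 2 + pY y * κ) := by
            refine sum_le_sum fun y _ => ?_
            rw [hb, hHeq s s' hAs]
            nlinarith [mul_le_mul_of_nonneg_left (hs₀min y s hAs)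
              (mul_nonneg (hpY0 y) hlog2.le)]
        _ = _ := by
            simp only [sum_add_distrib, ← sum_mul]
            rw [hpY1, ← hIX, ← hG2, hκ, hK]
            ring
    · rw [hG₃]
      exact (sum_nonneg fun z _ => mul_nonneg (hℓ0 _ _) (sqrt_nonneg _)).trans
        (le_sup' (fun y => ∑ z ∈ Ztyp s y,
          ℓ (B s z) y * Real.sqrt (2 * (Fintype.card 𝒴) * pZy s y z))
          (mem_univ (Classical.arbitrary 𝒴)))
    · rw [div_mul_eq_mul_div]
      refine div_le_div_of_nonneg_right ?_ (sqrt_nonneg _)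
      rw [hG₁]
      refine le_add_of_nonneg_left (div_nonneg (mul_nonneg (mul_nonneg ?_ (sqrt_nonneg _))
        (sqrt_nonneg _)) (by positivity))
      rw [hL]
      exact Real.iSup_nonneg fun i => hℓ0 _ _
  have hfail : ∑ s with ¬ Δ s ≤ bound s, Pn s ≤ δ := by
    rw [← sum_fiberwise_of_maps_to (g := A) (t := ℳ) fun s _ => hA s]
    refine le_trans (sum_le_sum fun q _ => ?_) (sum_min_le_of_rpow_mul_sum_le ℳ pφ hpφ0
      ((sum_le_sum_of_subset_of_nonneg (subset_univ _) fun q _ _ => hpφ0 q).trans hpφ1.le)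
      lam δ u hlam hδ0 hδ1 hu0 hulam)
    rw [filter_filter]
    refine le_min ?_ ?_
    · rw [hpφ]
      refine sum_le_sum_of_subset_of_nonneg ?_ fun s _ _ => hPn0 s
      intro s hs
      simp only [mem_filter] at hs ⊢
      exact ⟨hs.1, hs.2.2⟩
    · by_cases hq : ∃ s', A s' = q
      · obtain ⟨s', rfl⟩ := hq
        simp_rw [and_comm (a := ¬ Δ _ ≤ bound _)]
        exact hfix s'
      · rw [filter_false_of_mem fun s _ hs => hq ⟨s, hs.2⟩, sum_empty]
        positivity
  have htot := sum_filter_add_sum_filter_not univ (fun s => Δ s ≤ bound s) Pn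
  rw [hPn1] at htot
  linarith
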